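/- Let T : ℂ^n → ℂ^N and T̃ = (T†)* satisfy the incoherence bound μ ≥ max_{k∈[n]} max{ n‖γ^{1/2} T e_k‖_∞², n‖γ^{−1/2} T̃ e_k‖_∞² } with balancing parameter γ and ‖γ T*T − I_n‖ < 1. Let J ⊆ [N] be a fixed set with |J| = s, and let Ω = {ω_1,…,ω_m} be i.i.d. uniform random indices in [n]. Then for every δ > 0, P( ‖ Π_J ( (n/m) T S_Ω* S_Ω T† − T T† ) Π_J ‖ ≥ δ ) ≤ 2s · exp( − (m/(sμ)) · (δ²/2) / ( 1/(1 − ‖γ T*T − I_n‖) + δ/3 ) ). -/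

import Mathlib

open scoped BigOperators ENNReal
open Classical MeasureTheory
open scoped Matrix

noncomputable section

namespace TSR

/-- ℓ2 norm of a finite complex vector. -/
def l2norm {d : ℕ} (v : Fin d → ℂ) : ℝ := Real.sqrt (∑ i, ‖v i‖ ^ 2)

/-- ℓ1 norm of a finite complex vector. -/
def l1norm {d : ℕ} (v : Fin d → ℂ) : ℝ := ∑ i, ‖v i‖

/-- ℓ∞ norm of a finite complex vector. -/
def linfnorm {d : ℕ} (v : Fin d → ℂ) : ℝ := ⨆ i, ‖v i‖

/-- Spectral norm (`ℓ2 → ℓ2` operator norm) of a matrix. -/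
def specNorm {d e : ℕ} (A : Matrix (Fin d) (Fin e) ℂ) : ℝ :=
  ‖LinearMap.toContinuousLinearMap (Matrix.toEuclideanLin A)‖

/-- Largest singular value. -/
def sigmaMax {d e : ℕ} (A : Matrix (Fin d) (Fin e) ℂ) : ℝ := specNorm A

/-- Smallest singular value: the infimum of `‖A v‖₂` over unit vectors `v`. -/
def sigmaMin {d e : ℕ} (A : Matrix (Fin d) (Fin e) ℂ) : ℝ :=
  sInf {r : ℝ | ∃ v : Fin e → ℂ, l2norm v = 1 ∧ r = l2norm (A.mulVec v)}

/-- Maximum ℓ2 norm of the columns of a matrix (the `1 → 2` operator norm). -/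
def maxColL2 {d e : ℕ} (A : Matrix (Fin d) (Fin e) ℂ) : ℝ :=
  ⨆ k : Fin e, l2norm (fun i => A i k)

/-- `B` is the Moore–Penrose pseudoinverse of `A` (the four Penrose conditions). -/
def IsMoorePenrose {ι κ : Type*} [Fintype ι] [Fintype κ] [DecidableEq ι] [DecidableEq κ]
    (A : Matrix ι κ ℂ) (B : Matrix κ ι ℂ) : Prop :=
  A * B * A = A ∧ B * A * B = B ∧ (A * B)ᴴ = A * B ∧ (B * A)ᴴ = B * A

/-- `γ > 0` minimizes `‖γ' T*T − I‖` over `γ' > 0` (the balancing parameter). -/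
def IsBalancing {e d : ℕ} (T : Matrix (Fin d) (Fin e) ℂ) (γ : ℝ) : Prop :=
  0 < γ ∧ ∀ γ' : ℝ, 0 < γ' →
    specNorm ((γ : ℂ) • (Tᴴ * T) - 1) ≤ specNorm ((γ' : ℂ) • (Tᴴ * T) - 1)

/-- Local incoherence parameter `n γ ‖A e_k‖_∞²` of the `k`-th column. -/
def locIncoh {e d : ℕ} (γ : ℝ) (A : Matrix (Fin d) (Fin e) ℂ) (k : Fin e) : ℝ :=
  (e : ℝ) * γ * (linfnorm fun i => A i k) ^ 2

/-- The (worst case) incoherence parameter `μ`. -/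
def incoherence {e d : ℕ} (γ : ℝ) (T Ttil : Matrix (Fin d) (Fin e) ℂ) : ℝ :=
  ⨆ k : Fin e, max (locIncoh γ T k) (locIncoh γ⁻¹ Ttil k)

/-- The variable-density weight `√(μ_k μ̃_k)`. -/
def vdWeight {e d : ℕ} (γ : ℝ) (T Ttil : Matrix (Fin d) (Fin e) ℂ) (k : Fin e) : ℝ :=
  Real.sqrt (locIncoh γ T k * locIncoh γ⁻¹ Ttil k)

/-- The average incoherence parameter `μ̄ = (1/n) ∑ √(μ_k μ̃_k)`. -/
def avgIncoh {e d : ℕ} (γ : ℝ) (T Ttil : Matrix (Fin d) (Fin e) ℂ) : ℝ :=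
  (1 / (e : ℝ)) * ∑ k, vdWeight γ T Ttil k

/-- The sampling matrix `S_Ω` of a multiset of indices `ω : Fin m → Fin n`. -/
def sampMat {n m : ℕ} (ω : Fin m → Fin n) : Matrix (Fin m) (Fin n) ℂ :=
  fun j k => if ω j = k then 1 else 0

/-- Coordinate projection `Π_J` onto a set of coordinates, as a matrix. -/
def projMat {d : ℕ} (J : Set (Fin d)) : Matrix (Fin d) (Fin d) ℂ :=
  fun i j => if i = j ∧ i ∈ J then 1 else 0

/-- Number of non-zero entries. -/
def sparsity {d : ℕ} (v : Fin d → ℂ) : ℕ :=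
  (Finset.univ.filter fun i => v i ≠ 0).card

/-- Number of distinct elements of the multiset `Ω` (that is, `|Ω'|`). -/
def distinctCard {n m : ℕ} (ω : Fin m → Fin n) : ℕ :=
  (Finset.image ω Finset.univ).card

/-- Maximal multiplicity of an element of the multiset `Ω`. -/
def maxMult {n m : ℕ} (ω : Fin m → Fin n) : ℕ :=
  Finset.univ.sup fun k : Fin n => (Finset.univ.filter fun j => ω j = k).card

/-- Entrywise complex signum. -/
def csgn {d : ℕ} (z : Fin d → ℂ) : Fin d → ℂ :=
  fun k => if z k = 0 then 0 else z k / (‖z k‖ : ℂ)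

/-- `G` is a partition of the coordinates into disjoint nonempty groups. -/
def IsPartition {L N : ℕ} (G : Fin N → Finset (Fin L)) : Prop :=
  (∀ j, (G j).Nonempty) ∧ (∀ j j', j ≠ j' → Disjoint (G j) (G j')) ∧
    Finset.univ.biUnion G = Finset.univ

/-- The mixed (group) norm `‖z‖_{𝒢,1} = ∑_j ‖Π_{𝒢_j} z‖₂`. -/
def mixedNorm {L N : ℕ} (G : Fin N → Finset (Fin L)) (z : Fin L → ℂ) : ℝ :=
  ∑ j, Real.sqrt (∑ i ∈ G j, ‖z i‖ ^ 2)

/-- `z` is `(s,t)` strongly group sparse with respect to the partition `G`. -/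
def StronglyGroupSparse {L N : ℕ} (G : Fin N → Finset (Fin L)) (s t : ℕ)
    (z : Fin L → ℂ) : Prop :=
  ∃ J : Finset (Fin N), (∀ i, z i ≠ 0 → i ∈ J.biUnion G) ∧
    (J.biUnion G).card ≤ t ∧ J.card ≤ s

/-- Group local incoherence `max_j n γ ‖Π_{𝒢_j} A e_k‖₂²`. -/
def groupLocIncoh {n L N : ℕ} (G : Fin N → Finset (Fin L)) (γ : ℝ)
    (A : Matrix (Fin L) (Fin n) ℂ) (k : Fin n) : ℝ :=
  ⨆ j : Fin N, (n : ℝ) * γ * ∑ i ∈ G j, ‖A i k‖ ^ 2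

/-- Group incoherence parameter `μ_𝒢`. -/
def groupIncoh {n L N : ℕ} (G : Fin N → Finset (Fin L)) (γ : ℝ)
    (T Ttil : Matrix (Fin L) (Fin n) ℂ) : ℝ :=
  ⨆ k : Fin n, max (groupLocIncoh G γ T k) (groupLocIncoh G γ⁻¹ Ttil k)

/-- Group variable density weight `√(μ_{𝒢,k} μ̃_{𝒢,k})`. -/
def groupVdWeight {n L N : ℕ} (G : Fin N → Finset (Fin L)) (γ : ℝ)
    (T Ttil : Matrix (Fin L) (Fin n) ℂ) (k : Fin n) : ℝ :=
  Real.sqrt (groupLocIncoh G γ T k * groupLocIncoh G γ⁻¹ Ttil k)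

/-- Group average incoherence `μ̄_𝒢`. -/
def groupAvgIncoh {n L N : ℕ} (G : Fin N → Finset (Fin L)) (γ : ℝ)
    (T Ttil : Matrix (Fin L) (Fin n) ℂ) : ℝ :=
  (1 / (n : ℝ)) * ∑ k, groupVdWeight G γ T Ttil k

/-- The unitary DFT matrix. -/
def dft (n : ℕ) : Matrix (Fin n) (Fin n) ℂ :=
  fun j k => ((1 / Real.sqrt n : ℝ) : ℂ) *
    Complex.exp (-(2 * Real.pi * Complex.I * (j : ℕ) * (k : ℕ)) / n)

section Spectral

variable {ι : Type*} [Fintype ι] [DecidableEq ι]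

/-- The Hermitian matrix with eigenvectors the columns of `U` and eigenvalues `d`. -/
def spec (U : Matrix ι ι ℂ) (d : ι → ℝ) : Matrix ι ι ℂ :=
  U * Matrix.diagonal (fun i => (d i : ℂ)) * Uᴴ

theorem exists_eq_spec {A : Matrix ι ι ℂ} (hA : A.IsHermitian) :
    ∃ U ∈ Matrix.unitaryGroup ι ℂ, ∃ d : ι → ℝ, A = spec U d := by
  refine ⟨hA.eigenvectorUnitary, hA.eigenvectorUnitary.2, hA.eigenvalues, ?_⟩
  conv_lhs => rw [hA.spectral_theorem, Unitary.conjStarAlgAut_apply]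
  rfl

theorem spec_isHermitian (U : Matrix ι ι ℂ) (d : ι → ℝ) : (spec U d).IsHermitian := by
  simp [spec, Matrix.IsHermitian, Matrix.conjTranspose_mul, Matrix.diagonal_conjTranspose,
    Matrix.mul_assoc, Pi.star_def]

theorem unitary_mul_conjTranspose {U : Matrix ι ι ℂ} (hU : U ∈ Matrix.unitaryGroup ι ℂ) :
    U * Uᴴ = 1 := Matrix.mem_unitaryGroup_iff.1 hU

theorem unitary_conjTranspose_mul {U : Matrix ι ι ℂ} (hU : U ∈ Matrix.unitaryGroup ι ℂ) :
    Uᴴ * U = 1 := Matrix.mem_unitaryGroup_iff'.1 hU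

theorem exp_spec {U : Matrix ι ι ℂ} (hU : U ∈ Matrix.unitaryGroup ι ℂ) (d : ι → ℝ) :
    NormedSpace.exp (spec U d) = spec U (fun i => Real.exp (d i)) := by
  have hinv : U⁻¹ = Uᴴ := Matrix.inv_eq_right_inv (unitary_mul_conjTranspose hU)
  have hunit : IsUnit U :=
    IsUnit.of_mul_eq_one _ (unitary_mul_conjTranspose hU)
  rw [spec, ← hinv, Matrix.exp_conj _ _ hunit, Matrix.exp_diagonal, spec, ← hinv]
  congr 3
  funext i
  rw [Pi.coe_exp, ← Complex.exp_eq_exp_ℂ, Complex.ofReal_exp]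

theorem spec_one {U : Matrix ι ι ℂ} (hU : U ∈ Matrix.unitaryGroup ι ℂ) :
    spec U (fun _ => 1) = 1 := by
  simp [spec, unitary_mul_conjTranspose hU]

theorem spec_mul {U : Matrix ι ι ℂ} (hU : U ∈ Matrix.unitaryGroup ι ℂ) (a b : ι → ℝ) :
    spec U a * spec U b = spec U (fun i => a i * b i) := by
  have : spec U a * spec U b = U * (Matrix.diagonal (fun i => (a i : ℂ)) * (Uᴴ * U) *
      Matrix.diagonal (fun i => (b i : ℂ))) * Uᴴ := by
    simp only [spec, Matrix.mul_assoc]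
  rw [this, unitary_conjTranspose_mul hU, mul_one, Matrix.diagonal_mul_diagonal]
  simp [spec]

theorem spec_sub (U : Matrix ι ι ℂ) (a b : ι → ℝ) :
    spec U a - spec U b = spec U (fun i => a i - b i) := by
  simp [spec, ← Matrix.mul_sub, ← Matrix.sub_mul, Matrix.diagonal_sub]

theorem spec_add (U : Matrix ι ι ℂ) (a b : ι → ℝ) :
    spec U a + spec U b = spec U (fun i => a i + b i) := by
  simp [spec, ← Matrix.mul_add, ← Matrix.add_mul, Matrix.diagonal_add]

theorem smul_spec (U : Matrix ι ι ℂ) (c : ℝ) (a : ι → ℝ) :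
    c • spec U a = spec U (fun i => c * a i) := by
  have : Matrix.diagonal (fun i => ((c * a i : ℝ) : ℂ)) =
      c • Matrix.diagonal (fun i => (a i : ℂ)) := by
    rw [← Matrix.diagonal_smul]
    congr 1
    funext i
    simp
  rw [spec, spec, this]
  simp

theorem exp_isHermitian {A : Matrix ι ι ℂ} (hA : A.IsHermitian) :
    (NormedSpace.exp A).IsHermitian := hA.exp

/-- The quadratic form of a spectral matrix. -/
theorem dotProduct_spec_mulVec (U : Matrix ι ι ℂ) (d : ι → ℝ) (v : ι → ℂ) :
    (star v ⬝ᵥ spec U d *ᵥ v).re = ∑ i, d i * ‖(Uᴴ *ᵥ v) i‖ ^ 2 := by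
  have : star v ⬝ᵥ spec U d *ᵥ v =
      star (Uᴴ *ᵥ v) ⬝ᵥ (Matrix.diagonal (fun i => (d i : ℂ)) *ᵥ (Uᴴ *ᵥ v)) := by
    rw [Matrix.star_mulVec, Matrix.conjTranspose_conjTranspose, ← Matrix.dotProduct_mulVec,
      spec, Matrix.mulVec_mulVec, Matrix.mulVec_mulVec]
  rw [this, dotProduct, Complex.re_sum]
  refine Finset.sum_congr rfl fun i _ => ?_
  rw [Matrix.mulVec_diagonal, Pi.star_apply, ← Complex.normSq_eq_norm_sq, Complex.normSq_apply]
  simp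
  ring

/-- The real part of the quadratic form of `A` is nonnegative. -/
def NonnegForm (A : Matrix ι ι ℂ) : Prop := ∀ v : ι → ℂ, 0 ≤ (star v ⬝ᵥ A *ᵥ v).re

theorem re_trace_spec_mul (U : Matrix ι ι ℂ) (d : ι → ℝ) (A : Matrix ι ι ℂ) :
    (spec U d * A).trace.re = ∑ i, d i * (star (U.col i) ⬝ᵥ A *ᵥ U.col i).re := by
  have : (spec U d * A).trace = (Matrix.diagonal (fun i => (d i : ℂ)) * (Uᴴ * A * U)).trace := by
    rw [spec, Matrix.mul_assoc, Matrix.mul_assoc, Matrix.trace_mul_comm]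
    simp [Matrix.mul_assoc]
  rw [this, Matrix.trace, Complex.re_sum]
  refine Finset.sum_congr rfl fun i _ => ?_
  rw [Matrix.diag_apply, Matrix.diagonal_mul, Complex.re_ofReal_mul]
  congr 2
  simp only [Matrix.mul_apply, dotProduct, Matrix.mulVec, Matrix.conjTranspose_apply,
    Pi.star_apply, Matrix.col_apply, Finset.mul_sum, Finset.sum_mul, mul_assoc]
  exact Finset.sum_comm

theorem re_trace_exp_mul_nonneg {P A : Matrix ι ι ℂ} (hP : P.IsHermitian) (hA : NonnegForm A) :
    0 ≤ (NormedSpace.exp P * A).trace.re := by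
  obtain ⟨U, hU, p, rfl⟩ := exists_eq_spec hP
  rw [exp_spec hU, re_trace_spec_mul]
  exact Finset.sum_nonneg fun i _ => mul_nonneg (Real.exp_nonneg _) (hA _)

theorem exp_form_pos {P : Matrix ι ι ℂ} (hP : P.IsHermitian) {v : ι → ℂ} (hv : v ≠ 0) :
    0 < (star v ⬝ᵥ NormedSpace.exp P *ᵥ v).re := by
  obtain ⟨U, hU, p, rfl⟩ := exists_eq_spec hP
  rw [exp_spec hU, dotProduct_spec_mulVec]
  have hne : Uᴴ *ᵥ v ≠ 0 := by
    intro h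
    apply hv
    rw [← Matrix.one_mulVec v, ← unitary_mul_conjTranspose hU, ← Matrix.mulVec_mulVec, h,
      Matrix.mulVec_zero]
  obtain ⟨i, hi⟩ := Function.ne_iff.1 hne
  refine Finset.sum_pos' (fun j _ => by positivity) ⟨i, Finset.mem_univ _, ?_⟩
  have : 0 < ‖(Uᴴ *ᵥ v) i‖ := norm_pos_iff.2 hi
  positivity

theorem dotProduct_spec_mulVec_col {U : Matrix ι ι ℂ} (hU : U ∈ Matrix.unitaryGroup ι ℂ)
    (d : ι → ℝ) (i : ι) :
    (star (U *ᵥ Pi.single i 1) ⬝ᵥ spec U d *ᵥ (U *ᵥ Pi.single i 1)).re = d i := by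
  rw [dotProduct_spec_mulVec, Matrix.mulVec_mulVec, unitary_conjTranspose_mul hU,
    Matrix.one_mulVec, Finset.sum_eq_single i]
  · simp
  · intro j _ hj
    simp [Pi.single_eq_of_ne hj]
  · simp

theorem exists_exp_eq {M : Matrix ι ι ℂ} (hM : M.IsHermitian)
    (hpos : ∀ v : ι → ℂ, v ≠ 0 → 0 < (star v ⬝ᵥ M *ᵥ v).re) :
    ∃ Q : Matrix ι ι ℂ, Q.IsHermitian ∧ NormedSpace.exp Q = M := by
  obtain ⟨U, hU, d, rfl⟩ := exists_eq_spec hM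
  refine ⟨spec U (fun i => Real.log (d i)), spec_isHermitian _ _, ?_⟩
  rw [exp_spec hU]
  congr 1
  funext i
  refine Real.exp_log ?_
  have hne : U *ᵥ Pi.single i (1 : ℂ) ≠ 0 := by
    intro h
    have := congrFun (congrArg (Uᴴ *ᵥ ·) h) i
    rw [Matrix.mulVec_mulVec, unitary_conjTranspose_mul hU, Matrix.one_mulVec,
      Matrix.mulVec_zero] at this
    simp at this
  rw [← dotProduct_spec_mulVec_col hU d i]
  exact hpos _ hne

theorem nonnegForm_spec {U : Matrix ι ι ℂ} {d : ι → ℝ} (hd : ∀ i, 0 ≤ d i) :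
    NonnegForm (spec U d) := fun v => by
  rw [dotProduct_spec_mulVec]
  exact Finset.sum_nonneg fun i _ => mul_nonneg (hd i) (sq_nonneg _)

theorem nonnegForm_exp_sub_one_sub {Q : Matrix ι ι ℂ} (hQ : Q.IsHermitian) :
    NonnegForm (NormedSpace.exp Q - 1 - Q) := by
  obtain ⟨U, hU, q, rfl⟩ := exists_eq_spec hQ
  rw [exp_spec hU, ← spec_one hU, spec_sub, spec_sub]
  refine nonnegForm_spec fun i => ?_
  have := Real.add_one_le_exp (q i)
  linarith

theorem NonnegForm.add {ι : Type*} [Fintype ι] {A B : Matrix ι ι ℂ} (hA : NonnegForm A)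
    (hB : NonnegForm B) : NonnegForm (A + B) := fun v => by
  rw [Matrix.add_mulVec, dotProduct_add, Complex.add_re]
  exact add_nonneg (hA v) (hB v)

theorem re_trace_spec_mul_spec (U V : Matrix ι ι ℂ) (a b : ι → ℝ) :
    (spec U a * spec V b).trace.re = ∑ i, ∑ j, a i * b j * ‖(Uᴴ * V) i j‖ ^ 2 := by
  rw [re_trace_spec_mul]
  refine Finset.sum_congr rfl fun i _ => ?_
  rw [dotProduct_spec_mulVec, Finset.mul_sum]
  refine Finset.sum_congr rfl fun j _ => ?_
  have : (Vᴴ *ᵥ U.col i) j = star ((Uᴴ * V) i j) := by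
    rw [← Matrix.conjTranspose_apply, Matrix.conjTranspose_mul, Matrix.conjTranspose_conjTranspose]
    rfl
  rw [this, norm_star, mul_assoc]

end Spectral

section RelativeEntropy

/-- Integral representation of the scalar Bregman divergence of `x log x`. -/
theorem integral_bregman {a b : ℝ} (ha : 0 < a) (hb : 0 < b) :
    IntervalIntegrable (fun u => (1 - u) * ((a - b) ^ 2 / (u * a + (1 - u) * b)))
      volume 0 1 ∧
    ∫ u in (0 : ℝ)..1, (1 - u) * ((a - b) ^ 2 / (u * a + (1 - u) * b)) =
      a * (Real.log a - Real.log b) - a + b := by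
  have hpos : ∀ u ∈ Set.uIcc (0 : ℝ) 1, 0 < u * a + (1 - u) * b := by
    intro u hu
    rw [Set.uIcc_of_le zero_le_one] at hu
    rcases hu.1.eq_or_lt with h | h
    · simp [← h, hb]
    · have := mul_pos h ha
      have := mul_nonneg (sub_nonneg.2 hu.2) hb.le
      linarith
  have hint : IntervalIntegrable (fun u => (1 - u) * ((a - b) ^ 2 / (u * a + (1 - u) * b)))
      volume 0 1 := by
    refine ContinuousOn.intervalIntegrable ?_
    refine ContinuousOn.mul (by fun_prop) (ContinuousOn.div (by fun_prop) (by fun_prop) ?_)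
    exact fun u hu => (hpos u hu).ne'
  refine ⟨hint, ?_⟩
  rw [intervalIntegral.integral_eq_sub_of_hasDerivAt (f := fun u =>
    (1 - u) * (a - b) * (Real.log (u * a + (1 - u) * b) + 1) +
      (u * a + (1 - u) * b) * Real.log (u * a + (1 - u) * b)) ?_ hint]
  · simp
    ring
  · intro u hu
    have hx := (hpos u hu).ne'
    have h1 : HasDerivAt (fun u : ℝ => u * a + (1 - u) * b) (a - b) u := by
      refine (((hasDerivAt_id' u).mul_const a).add
        (((hasDerivAt_id' u).const_sub 1).mul_const b)).congr_deriv ?_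
      ring
    have h2 := h1.log hx
    have h3 : HasDerivAt (fun u : ℝ => (1 - u) * (a - b)) (-(a - b)) u := by
      refine (((hasDerivAt_id' u).const_sub 1).mul_const (a - b)).congr_deriv ?_
      ring
    refine ((h3.mul (h2.add_const 1)).add (h1.mul h2)).congr_deriv ?_
    generalize u * a + (1 - u) * b = x at hx
    field_simp
    ring

variable {ι : Type*} [Fintype ι] [DecidableEq ι]

/-- Umegaki relative entropy of `exp P` and `exp Q`, with the linear correction terms. -/
def relEntropy (P Q : Matrix ι ι ℂ) : ℝ :=
  (NormedSpace.exp P * (P - Q)).trace.re - (NormedSpace.exp P).trace.re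
    + (NormedSpace.exp Q).trace.re

theorem relEntropy_spec {U V : Matrix ι ι ℂ} (hU : U ∈ Matrix.unitaryGroup ι ℂ)
    (hV : V ∈ Matrix.unitaryGroup ι ℂ) (p q : ι → ℝ) :
    relEntropy (spec U p) (spec V q) = ∑ i, ∑ j, (Real.exp (p i) * (p i - q j)
      - Real.exp (p i) + Real.exp (q j)) * ‖(Uᴴ * V) i j‖ ^ 2 := by
  have h1 : (NormedSpace.exp (spec U p) * spec U p).trace.re =
      ∑ i, ∑ j, Real.exp (p i) * p i * ‖(Uᴴ * V) i j‖ ^ 2 := by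
    rw [exp_spec hU, spec_mul hU, ← mul_one (spec U _), ← spec_one hV, re_trace_spec_mul_spec]
    simp
  have h2 : (NormedSpace.exp (spec U p)).trace.re =
      ∑ i, ∑ j, Real.exp (p i) * ‖(Uᴴ * V) i j‖ ^ 2 := by
    rw [exp_spec hU, ← mul_one (spec U _), ← spec_one hV, re_trace_spec_mul_spec]
    simp
  have h3 : (NormedSpace.exp (spec V q)).trace.re =
      ∑ i, ∑ j, Real.exp (q j) * ‖(Uᴴ * V) i j‖ ^ 2 := by
    rw [exp_spec hV, ← one_mul (spec V _), ← spec_one hU, re_trace_spec_mul_spec]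
    simp
  have h4 : (NormedSpace.exp (spec U p) * spec V q).trace.re =
      ∑ i, ∑ j, Real.exp (p i) * q j * ‖(Uᴴ * V) i j‖ ^ 2 := by
    rw [exp_spec hU, re_trace_spec_mul_spec]
  rw [relEntropy, Matrix.mul_sub, Matrix.trace_sub, Complex.sub_re, h1, h2, h3, h4]
  simp only [← Finset.sum_sub_distrib, ← Finset.sum_add_distrib]
  refine Finset.sum_congr rfl fun i _ => Finset.sum_congr rfl fun j _ => ?_
  ring

/-- Klein's inequality. -/
theorem relEntropy_nonneg {P Q : Matrix ι ι ℂ} (hP : P.IsHermitian) (hQ : Q.IsHermitian) :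
    0 ≤ relEntropy P Q := by
  obtain ⟨U, hU, p, rfl⟩ := exists_eq_spec hP
  obtain ⟨V, hV, q, rfl⟩ := exists_eq_spec hQ
  rw [relEntropy_spec hU hV]
  refine Finset.sum_nonneg fun i _ => Finset.sum_nonneg fun j _ =>
    mul_nonneg ?_ (sq_nonneg _)
  have h := mul_le_mul_of_nonneg_left (Real.add_one_le_exp (q j - p i)) (Real.exp_nonneg (p i))
  rw [← Real.exp_add, add_sub_cancel] at h
  linarith

/-- For fixed `Y`, a functional linear in `(A, B)` whose supremum over `Y` is a weighted
quadratic-over-linear expression in `A - B`. -/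
def quadMinorant (u : ℝ) (Y A B : Matrix ι ι ℂ) : ℝ :=
  2 * (Yᴴ * (A - B)).trace.re - u * (Yᴴ * A * Y).trace.re - (1 - u) * (Yᴴ * (Y * B)).trace.re

theorem trace_conj_left {U V : Matrix ι ι ℂ} (hU : U ∈ Matrix.unitaryGroup ι ℂ)
    (hV : V ∈ Matrix.unitaryGroup ι ℂ) (X Z : Matrix ι ι ℂ) :
    (Xᴴ * Z).trace = ((Uᴴ * X * V)ᴴ * (Uᴴ * Z * V)).trace := by
  have : (Uᴴ * X * V)ᴴ * (Uᴴ * Z * V) = Vᴴ * (Xᴴ * ((U * Uᴴ) * Z * V)) := by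
    simp [Matrix.conjTranspose_mul, Matrix.mul_assoc]
  rw [this, unitary_mul_conjTranspose hU, one_mul, Matrix.trace_mul_comm Vᴴ]
  simp only [Matrix.mul_assoc]
  rw [unitary_mul_conjTranspose hV, mul_one]

theorem re_trace_conjTranspose_mul {ι : Type*} [Fintype ι] (X Z : Matrix ι ι ℂ) :
    (Xᴴ * Z).trace.re = ∑ i, ∑ j, (star (X i j) * Z i j).re := by
  simp only [Matrix.trace, Matrix.diag_apply, Matrix.mul_apply, Matrix.conjTranspose_apply,
    Complex.re_sum]
  exact Finset.sum_comm

theorem quadMinorant_spec {U V : Matrix ι ι ℂ} (hU : U ∈ Matrix.unitaryGroup ι ℂ)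
    (hV : V ∈ Matrix.unitaryGroup ι ℂ) (u : ℝ) (Y : Matrix ι ι ℂ) (a b : ι → ℝ) :
    quadMinorant u Y (spec U a) (spec V b) =
      ∑ i, ∑ j, (2 * ((a i - b j) * (star ((Uᴴ * Y * V) i j) * (Uᴴ * V) i j).re)
        - (u * a i + (1 - u) * b j) * ‖(Uᴴ * Y * V) i j‖ ^ 2) := by
  have hA : ∀ X, Uᴴ * (spec U a * X) * V =
      Matrix.diagonal (fun i => (a i : ℂ)) * (Uᴴ * X * V) := fun X => by
    have : Uᴴ * (spec U a * X) * V =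
      (Uᴴ * U) * (Matrix.diagonal (fun i => (a i : ℂ)) * (Uᴴ * X * V)) := by
      simp only [spec, Matrix.mul_assoc]
    rw [this, unitary_conjTranspose_mul hU, one_mul]
  have hB : ∀ X, Uᴴ * (X * spec V b) * V =
      (Uᴴ * X * V) * Matrix.diagonal (fun i => (b i : ℂ)) := fun X => by
    have : Uᴴ * (X * spec V b) * V =
      (Uᴴ * X * V) * Matrix.diagonal (fun i => (b i : ℂ)) * (Vᴴ * V) := by
      simp only [spec, Matrix.mul_assoc]
    rw [this, unitary_conjTranspose_mul hV, mul_one]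
  have h1 : (Yᴴ * (spec U a - spec V b)).trace.re =
      ∑ i, ∑ j, (a i - b j) * (star ((Uᴴ * Y * V) i j) * (Uᴴ * V) i j).re := by
    rw [trace_conj_left hU hV, re_trace_conjTranspose_mul, Matrix.mul_sub, Matrix.sub_mul]
    have e1 := hA 1
    have e2 := hB 1
    rw [mul_one, mul_one] at e1
    rw [one_mul, mul_one] at e2
    rw [e1, e2]
    refine Finset.sum_congr rfl fun i _ => Finset.sum_congr rfl fun j _ => ?_
    rw [Matrix.sub_apply, Matrix.diagonal_mul, Matrix.mul_diagonal, ← Complex.re_ofReal_mul]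
    congr 1
    push_cast
    ring
  have h2 : (Yᴴ * spec U a * Y).trace.re = ∑ i, ∑ j, a i * ‖(Uᴴ * Y * V) i j‖ ^ 2 := by
    rw [Matrix.mul_assoc, trace_conj_left hU hV, re_trace_conjTranspose_mul, hA]
    refine Finset.sum_congr rfl fun i _ => Finset.sum_congr rfl fun j _ => ?_
    rw [Matrix.diagonal_mul, ← Complex.normSq_eq_norm_sq, Complex.normSq_apply]
    simp
    ring
  have h3 : (Yᴴ * (Y * spec V b)).trace.re = ∑ i, ∑ j, b j * ‖(Uᴴ * Y * V) i j‖ ^ 2 := by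
    rw [trace_conj_left hU hV, re_trace_conjTranspose_mul, hB]
    refine Finset.sum_congr rfl fun i _ => Finset.sum_congr rfl fun j _ => ?_
    rw [Matrix.mul_diagonal, ← Complex.normSq_eq_norm_sq, Complex.normSq_apply]
    simp
    ring
  rw [quadMinorant, h1, h2, h3]
  simp only [Finset.mul_sum, ← Finset.sum_sub_distrib]
  refine Finset.sum_congr rfl fun i _ => Finset.sum_congr rfl fun j _ => ?_
  ring

theorem exists_integral_relEntropy {P Q : Matrix ι ι ℂ} (hP : P.IsHermitian)
    (hQ : Q.IsHermitian) :
    ∃ q : ℝ → ℝ, IntervalIntegrable (fun u => (1 - u) * q u) volume 0 1 ∧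
      ∫ u in (0 : ℝ)..1, (1 - u) * q u = relEntropy P Q ∧
      ∀ u ∈ Set.Icc (0 : ℝ) 1, IsGreatest
        (Set.range fun Y => quadMinorant u Y (NormedSpace.exp P) (NormedSpace.exp Q)) (q u) := by
  obtain ⟨U, hU, p, rfl⟩ := exists_eq_spec hP
  obtain ⟨V, hV, r, rfl⟩ := exists_eq_spec hQ
  have hi := fun i j => integral_bregman (Real.exp_pos (p i)) (Real.exp_pos (r j))
  let q : ℝ → ℝ := fun u => ∑ i, ∑ j, (Real.exp (p i) - Real.exp (r j)) ^ 2 /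
    (u * Real.exp (p i) + (1 - u) * Real.exp (r j)) * ‖(Uᴴ * V) i j‖ ^ 2
  have hq : (fun u => (1 - u) * q u) = fun u => ∑ i, ∑ j, (1 - u) *
      ((Real.exp (p i) - Real.exp (r j)) ^ 2 /
        (u * Real.exp (p i) + (1 - u) * Real.exp (r j))) * ‖(Uᴴ * V) i j‖ ^ 2 := by
    funext u
    simp only [q, Finset.mul_sum, mul_assoc]
  have hint : ∀ i j, IntervalIntegrable (fun u => (1 - u) *
      ((Real.exp (p i) - Real.exp (r j)) ^ 2 /
        (u * Real.exp (p i) + (1 - u) * Real.exp (r j))) * ‖(Uᴴ * V) i j‖ ^ 2) volume 0 1 :=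
    fun i j => (hi i j).1.mul_const _
  have hint' : ∀ i, IntervalIntegrable (fun u => ∑ j, (1 - u) *
      ((Real.exp (p i) - Real.exp (r j)) ^ 2 /
        (u * Real.exp (p i) + (1 - u) * Real.exp (r j))) * ‖(Uᴴ * V) i j‖ ^ 2) volume 0 1 :=
    fun i => by
      simpa only [Finset.sum_fn] using IntervalIntegrable.sum Finset.univ fun j _ => hint i j
  refine ⟨q, ?_, ?_, fun u hu => ?_⟩
  · rw [hq]
    simpa only [Finset.sum_fn] using IntervalIntegrable.sum Finset.univ fun i _ => hint' i
  · rw [hq, intervalIntegral.integral_finsetSum fun i _ => hint' i, relEntropy_spec hU hV]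
    refine Finset.sum_congr rfl fun i _ => ?_
    rw [intervalIntegral.integral_finsetSum fun j _ => hint i j]
    refine Finset.sum_congr rfl fun j _ => ?_
    rw [intervalIntegral.integral_mul_const, (hi i j).2, Real.log_exp, Real.log_exp]
  · have hpos : ∀ i j, 0 < u * Real.exp (p i) + (1 - u) * Real.exp (r j) := fun i j => by
      rcases hu.1.eq_or_lt with h | h
      · rw [← h]
        simp [Real.exp_pos]
      · have := mul_pos h (Real.exp_pos (p i))
        have := mul_nonneg (sub_nonneg.2 hu.2) (Real.exp_pos (r j)).le
        linarith
    rw [exp_spec hU, exp_spec hV]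
    constructor
    · let W : Matrix ι ι ℂ := Matrix.of fun i j =>
        (((Real.exp (p i) - Real.exp (r j)) /
          (u * Real.exp (p i) + (1 - u) * Real.exp (r j)) : ℝ) : ℂ) * (Uᴴ * V) i j
      refine ⟨U * W * Vᴴ, ?_⟩
      have hW : Uᴴ * (U * W * Vᴴ) * V = W := by
        have : Uᴴ * (U * W * Vᴴ) * V = (Uᴴ * U) * W * (Vᴴ * V) := by
          simp only [Matrix.mul_assoc]
        rw [this, unitary_conjTranspose_mul hU, unitary_conjTranspose_mul hV, one_mul, mul_one]
      beta_reduce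
      rw [quadMinorant_spec hU hV, hW]
      refine Finset.sum_congr rfl fun i _ => Finset.sum_congr rfl fun j _ => ?_
      have h := (hpos i j).ne'
      simp only [W, Matrix.of_apply]
      generalize (Uᴴ * V) i j = w
      generalize hx : u * Real.exp (p i) + (1 - u) * Real.exp (r j) = x at h ⊢
      generalize Real.exp (p i) - Real.exp (r j) = d
      rw [norm_mul, mul_pow, Complex.norm_real, Real.norm_eq_abs, sq_abs, star_mul',
        Complex.star_def, Complex.conj_ofReal, mul_assoc, Complex.re_ofReal_mul,
        ← Complex.normSq_eq_conj_mul_self, Complex.ofReal_re, Complex.normSq_eq_norm_sq]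
      field_simp
      ring
    · rintro _ ⟨Y, rfl⟩
      beta_reduce
      rw [quadMinorant_spec hU hV]
      refine Finset.sum_le_sum fun i _ => Finset.sum_le_sum fun j _ => ?_
      have h := hpos i j
      generalize (Uᴴ * V) i j = w
      generalize (Uᴴ * Y * V) i j = y
      generalize u * Real.exp (p i) + (1 - u) * Real.exp (r j) = x at h ⊢
      generalize Real.exp (p i) - Real.exp (r j) = d
      rw [div_mul_eq_mul_div, le_div_iff₀ h]
      have e : (star y * w).re = y.re * w.re + y.im * w.im := by simp
      rw [e, ← Complex.normSq_eq_norm_sq, ← Complex.normSq_eq_norm_sq, Complex.normSq_apply,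
        Complex.normSq_apply]
      nlinarith [sq_nonneg (d * w.re - x * y.re), sq_nonneg (d * w.im - x * y.im)]

/-- Joint convexity of the relative entropy, for uniform weights. -/
theorem relEntropy_jointly_convex {κ : Type*} [Fintype κ] {c : ℝ} (hc : 0 ≤ c)
    {P Q : κ → Matrix ι ι ℂ} {P₀ Q₀ : Matrix ι ι ℂ} (hP : ∀ k, (P k).IsHermitian)
    (hQ : ∀ k, (Q k).IsHermitian) (hP₀ : P₀.IsHermitian) (hQ₀ : Q₀.IsHermitian)
    (hPe : NormedSpace.exp P₀ = c • ∑ k, NormedSpace.exp (P k))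
    (hQe : NormedSpace.exp Q₀ = c • ∑ k, NormedSpace.exp (Q k)) :
    relEntropy P₀ Q₀ ≤ c * ∑ k, relEntropy (P k) (Q k) := by
  obtain ⟨q₀, hq₀i, hq₀, hg₀⟩ := exists_integral_relEntropy hP₀ hQ₀
  choose q hqi hq hg using fun k => exists_integral_relEntropy (hP k) (hQ k)
  have hsum : IntervalIntegrable (fun u => ∑ k, (1 - u) * q k u) volume 0 1 := by
    simpa only [Finset.sum_fn] using IntervalIntegrable.sum Finset.univ fun k _ => hqi k
  rw [← hq₀, Finset.sum_congr rfl fun k _ => (hq k).symm,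
    ← intervalIntegral.integral_finsetSum fun k _ => hqi k,
    ← intervalIntegral.integral_const_mul]
  refine intervalIntegral.integral_mono_on zero_le_one hq₀i (hsum.const_mul c) fun u hu => ?_
  obtain ⟨Y, hY⟩ := (hg₀ u hu).1
  have hlin : quadMinorant u Y (NormedSpace.exp P₀) (NormedSpace.exp Q₀) =
      c * ∑ k, quadMinorant u Y (NormedSpace.exp (P k)) (NormedSpace.exp (Q k)) := by
    rw [hPe, hQe]
    simp only [quadMinorant, ← smul_sub, ← Finset.sum_sub_distrib, Matrix.mul_smul,
      Matrix.smul_mul, Matrix.mul_sum, Matrix.sum_mul, Matrix.trace_smul, Matrix.trace_sum,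
      Complex.smul_re, Complex.re_sum, smul_eq_mul]
    simp only [Finset.mul_sum, ← Finset.sum_sub_distrib]
    refine Finset.sum_congr rfl fun k _ => ?_
    ring
  beta_reduce at hY
  rw [← hY, hlin, ← Finset.mul_sum, mul_left_comm]
  have hu' : 0 ≤ 1 - u := sub_nonneg.2 hu.2
  gcongr with k
  exact (hg k u hu).2 ⟨Y, rfl⟩

/-- A form of Lieb's concavity theorem: exponentiating a random Hermitian perturbation. -/
theorem avg_trace_exp_add_le {κ : Type*} [Fintype κ] [Nonempty κ] {c : ℝ} (hc : 0 < c)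
    {H C : Matrix ι ι ℂ} {X : κ → Matrix ι ι ℂ} (hH : H.IsHermitian) (hC : C.IsHermitian)
    (hX : ∀ k, (X k).IsHermitian)
    (hle : NonnegForm (C - (c • ∑ k, NormedSpace.exp (X k) - 1))) :
    c * ∑ k, (NormedSpace.exp (H + X k)).trace.re ≤ (NormedSpace.exp (H + C)).trace.re := by
  have hlog : ∀ Z : κ → Matrix ι ι ℂ, (∀ k, (Z k).IsHermitian) →
      ∃ Q : Matrix ι ι ℂ, Q.IsHermitian ∧
        NormedSpace.exp Q = c • ∑ k, NormedSpace.exp (Z k) := by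
    intro Z hZ
    refine exists_exp_eq ?_ fun v hv => ?_
    · simp only [Matrix.IsHermitian, Matrix.conjTranspose_smul, Matrix.conjTranspose_sum]
      simp [fun k => (exp_isHermitian (hZ k)).eq]
    · rw [Matrix.smul_mulVec, Matrix.sum_mulVec, dotProduct_smul, dotProduct_sum,
        Complex.smul_re, Complex.re_sum]
      exact mul_pos hc (Finset.sum_pos (fun k _ => exp_form_pos (hZ k) hv)
        Finset.univ_nonempty)
  obtain ⟨Q, hQ, hQe⟩ := hlog X hX
  obtain ⟨P, hP, hPe⟩ := hlog (fun k => H + X k) fun k => hH.add (hX k)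
  have hconv := relEntropy_jointly_convex hc.le (fun k => hH.add (hX k)) hX hP hQ hPe hQe
  have hklein := relEntropy_nonneg hP (hH.add hC)
  have hQC : NonnegForm (C - Q) := by
    have h := hle.add (nonnegForm_exp_sub_one_sub hQ)
    rw [← hQe] at h
    convert h using 1
    abel
  have htr := re_trace_exp_mul_nonneg hP hQC
  have htrP : (NormedSpace.exp P).trace.re = c * ∑ k, (NormedSpace.exp (H + X k)).trace.re := by
    rw [hPe]
    simp [Matrix.trace_smul, Matrix.trace_sum]
  have htrQ : (NormedSpace.exp Q).trace.re = c * ∑ k, (NormedSpace.exp (X k)).trace.re := by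
    rw [hQe]
    simp [Matrix.trace_smul, Matrix.trace_sum]
  have hPH : (NormedSpace.exp P * H).trace.re =
      c * ∑ k, (NormedSpace.exp (H + X k) * H).trace.re := by
    rw [hPe]
    simp [Matrix.trace_smul, Matrix.trace_sum, Matrix.sum_mul]
  have hR : c * ∑ k, relEntropy (H + X k) (X k) = (NormedSpace.exp P * H).trace.re -
      (NormedSpace.exp P).trace.re + (NormedSpace.exp Q).trace.re := by
    rw [hPH, htrP, htrQ]
    simp only [relEntropy, add_sub_cancel_right, Finset.sum_add_distrib, Finset.sum_sub_distrib]
    ring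
  rw [hR] at hconv
  rw [← htrP]
  simp only [relEntropy, Matrix.mul_sub, Matrix.mul_add, Matrix.trace_sub, Matrix.trace_add,
    Complex.sub_re, Complex.add_re] at hconv hklein htr
  linarith

end RelativeEntropy

section Bernstein

theorem bernstein_taylor_aux (y : ℝ) :
    (Real.exp y - 1 - y) * (1 - y / 3) ≤ y ^ 2 / 2 := by
  let h' : ℝ → ℝ := fun y => y - (Real.exp y - 1) * (1 - y / 3) + (Real.exp y - 1 - y) / 3
  let h : ℝ → ℝ := fun y => y ^ 2 / 2 - (Real.exp y - 1 - y) * (1 - y / 3)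
  have hlin : ∀ y : ℝ, HasDerivAt (fun y : ℝ => 1 - y / 3) (-(1 / 3)) y := fun y =>
    ((hasDerivAt_id' y).div_const 3).const_sub 1
  have hd' : ∀ y, HasDerivAt h' ((1 - Real.exp y * (1 - y)) / 3) y := fun y => by
    refine (((hasDerivAt_id' y).sub (((Real.hasDerivAt_exp y).sub_const 1).mul (hlin y))).add
      ((((Real.hasDerivAt_exp y).sub_const 1).sub (hasDerivAt_id' y)).div_const 3)).congr_deriv ?_
    ring
  have hd : ∀ y, HasDerivAt h (h' y) y := fun y => by
    refine (((hasDerivAt_pow 2 y).div_const 2).sub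
      ((((Real.hasDerivAt_exp y).sub_const 1).sub (hasDerivAt_id' y)).mul (hlin y))).congr_deriv ?_
    simp only [h', Pi.sub_apply]
    push_cast
    ring
  have hmono : Monotone h' := by
    refine monotone_of_deriv_nonneg (fun y => (hd' y).differentiableAt) fun y => ?_
    rw [(hd' y).deriv]
    have h1 := mul_le_mul_of_nonneg_left (Real.add_one_le_exp (-y)) (Real.exp_nonneg y)
    rw [← Real.exp_add, add_neg_cancel, Real.exp_zero] at h1
    linarith
  have h'0 : h' 0 = 0 := by simp [h']
  have h0 : h 0 = 0 := by simp [h]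
  have hcont : Continuous h := continuous_iff_continuousAt.2 fun y => (hd y).continuousAt
  have hnonneg : 0 ≤ h y := by
    rcases le_total 0 y with hy | hy
    · have : MonotoneOn h (Set.Ici 0) := by
        refine monotoneOn_of_deriv_nonneg (convex_Ici 0) hcont.continuousOn
          (fun y _ => (hd y).differentiableAt.differentiableWithinAt) fun y hy => ?_
        rw [interior_Ici] at hy
        rw [(hd y).deriv, ← h'0]
        exact hmono (le_of_lt hy)
      rw [← h0]
      exact this (Set.mem_Ici.2 le_rfl) hy hy
    · have : AntitoneOn h (Set.Iic 0) := by
        refine antitoneOn_of_deriv_nonpos (convex_Iic 0) hcont.continuousOn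
          (fun y _ => (hd y).differentiableAt.differentiableWithinAt) fun y hy => ?_
        rw [interior_Iic] at hy
        rw [(hd y).deriv, ← h'0]
        exact hmono (le_of_lt hy)
      rw [← h0]
      exact this hy (Set.mem_Iic.2 le_rfl) hy
  exact sub_nonneg.1 hnonneg

theorem exp_le_bernstein {y c : ℝ} (hyc : y ≤ c) (hc : c < 3) :
    Real.exp y ≤ 1 + y + 1 / 2 / (1 - c / 3) * y ^ 2 := by
  have h := bernstein_taylor_aux y
  have hpos : 0 < 1 - c / 3 := by linarith
  have h1 := Real.add_one_le_exp y
  have h2 : (Real.exp y - 1 - y) * (1 - c / 3) ≤ y ^ 2 / 2 := by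
    refine le_trans (mul_le_mul_of_nonneg_left ?_ ?_) h <;> linarith
  rw [← le_div_iff₀ hpos] at h2
  have : 1 / 2 / (1 - c / 3) * y ^ 2 = y ^ 2 / 2 / (1 - c / 3) := by ring
  linarith

/-- The squared Euclidean norm. -/
def sqNorm {α : Type*} [Fintype α] (v : α → ℂ) : ℝ := ∑ i, ‖v i‖ ^ 2

theorem sqNorm_nonneg {α : Type*} [Fintype α] (v : α → ℂ) : 0 ≤ sqNorm v :=
  Finset.sum_nonneg fun _ _ => sq_nonneg _

theorem re_star_dotProduct_self {α : Type*} [Fintype α] (v : α → ℂ) :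
    (star v ⬝ᵥ v).re = sqNorm v := by
  rw [dotProduct, Complex.re_sum]
  refine Finset.sum_congr rfl fun i _ => ?_
  rw [Pi.star_apply, Complex.star_def, ← Complex.normSq_eq_conj_mul_self, Complex.ofReal_re,
    Complex.normSq_eq_norm_sq]

variable {ι : Type*} [Fintype ι] [DecidableEq ι]

theorem trace_spec {U : Matrix ι ι ℂ} (hU : U ∈ Matrix.unitaryGroup ι ℂ) (d : ι → ℝ) :
    (spec U d).trace.re = ∑ i, d i := by
  rw [spec, Matrix.trace_mul_comm, ← Matrix.mul_assoc, unitary_conjTranspose_mul hU, one_mul,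
    Matrix.trace_diagonal]
  simp

theorem nonneg_of_nonnegForm_spec {U : Matrix ι ι ℂ} (hU : U ∈ Matrix.unitaryGroup ι ℂ)
    {d : ι → ℝ} (h : NonnegForm (spec U d)) (i : ι) : 0 ≤ d i := by
  rw [← dotProduct_spec_mulVec_col hU d i]
  exact h _

theorem nonnegForm_bernstein {D : Matrix ι ι ℂ} (hD : D.IsHermitian) {R t : ℝ}
    (hR : NonnegForm (R • (1 : Matrix ι ι ℂ) - D)) (ht : 0 ≤ t) (htR : t * R < 3) :
    NonnegForm (1 + t • D + (t ^ 2 / 2 / (1 - t * R / 3)) • (D * D)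
      - NormedSpace.exp (t • D)) := by
  obtain ⟨U, hU, d, rfl⟩ := exists_eq_spec hD
  rw [← spec_one hU, smul_spec, spec_sub] at hR
  rw [← spec_one hU, spec_mul hU, smul_spec, exp_spec hU, smul_spec, spec_add, spec_add, spec_sub]
  refine nonnegForm_spec fun i => ?_
  have h1 := nonneg_of_nonnegForm_spec hU hR i
  have h2 := exp_le_bernstein (mul_le_mul_of_nonneg_left (show d i ≤ R by linarith) ht) htR
  have : t ^ 2 / 2 / (1 - t * R / 3) * (d i * d i) =
    1 / 2 / (1 - t * R / 3) * (t * d i) ^ 2 := by ring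
  linarith

theorem NonnegForm.smul {ι : Type*} [Fintype ι] {A : Matrix ι ι ℂ} (hA : NonnegForm A)
    {c : ℝ} (hc : 0 ≤ c) : NonnegForm (c • A) := fun v => by
  rw [Matrix.smul_mulVec, dotProduct_smul, Complex.smul_re]
  exact mul_nonneg hc (hA v)

theorem nonnegForm_sum {ι : Type*} [Fintype ι] {κ : Type*} [Fintype κ] {A : κ → Matrix ι ι ℂ}
    (hA : ∀ k, NonnegForm (A k)) : NonnegForm (∑ k, A k) := fun v => by
  rw [Matrix.sum_mulVec, dotProduct_sum, Complex.re_sum]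
  exact Finset.sum_nonneg fun k _ => hA k v

theorem isHermitian_real_smul {ι : Type*} {A : Matrix ι ι ℂ} (hA : A.IsHermitian) (c : ℝ) :
    (c • A).IsHermitian := by
  rw [Matrix.IsHermitian, Matrix.conjTranspose_smul, hA.eq, star_trivial]

theorem isHermitian_sum {ι : Type*} {κ : Type*} [Fintype κ] {A : κ → Matrix ι ι ℂ}
    (hA : ∀ k, (A k).IsHermitian) : (∑ k, A k).IsHermitian := by
  rw [Matrix.IsHermitian, Matrix.conjTranspose_sum]
  exact Finset.sum_congr rfl fun k _ => (hA k).eq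

variable {κ : Type*} [Fintype κ] [Nonempty κ]

/-- Independent summands can be integrated out of the trace exponential one at a time. -/
theorem sum_trace_exp_le {c : ℝ} (hc : 0 < c) {C : Matrix ι ι ℂ} {X : κ → Matrix ι ι ℂ}
    (hC : C.IsHermitian) (hX : ∀ k, (X k).IsHermitian)
    (hle : NonnegForm (C - (c • ∑ k, NormedSpace.exp (X k) - 1))) (m : ℕ) :
    ∀ H : Matrix ι ι ℂ, H.IsHermitian →
      c ^ m * ∑ ω : Fin m → κ, (NormedSpace.exp (H + ∑ j, X (ω j))).trace.re ≤
        (NormedSpace.exp (H + (m : ℝ) • C)).trace.re := by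
  induction m with
  | zero => intro H hH; simp
  | succ m ih =>
    intro H hH
    have hsplit : ∑ ω : Fin (m + 1) → κ, (NormedSpace.exp (H + ∑ j, X (ω j))).trace.re =
        ∑ k, ∑ ω : Fin m → κ, (NormedSpace.exp ((H + X k) + ∑ j, X (ω j))).trace.re := by
      rw [← Fintype.sum_prod_type', ← (Fin.consEquiv fun _ => κ).sum_comp]
      refine Finset.sum_congr rfl fun p _ => ?_
      simp [Fin.consEquiv, Fin.sum_univ_succ, add_assoc]
    have hstep : ∀ k, c ^ m * ∑ ω : Fin m → κ,
        (NormedSpace.exp ((H + X k) + ∑ j, X (ω j))).trace.re ≤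
          (NormedSpace.exp ((H + (m : ℝ) • C) + X k)).trace.re := fun k => by
      have := ih (H + X k) (hH.add (hX k))
      rwa [add_right_comm] at this
    have hlast := avg_trace_exp_add_le hc (hH.add (isHermitian_real_smul hC m)) hC hX hle
    calc _ = c * ∑ k, c ^ m * ∑ ω : Fin m → κ,
          (NormedSpace.exp ((H + X k) + ∑ j, X (ω j))).trace.re := by
          rw [hsplit, ← Finset.mul_sum]
          ring
      _ ≤ c * ∑ k, (NormedSpace.exp ((H + (m : ℝ) • C) + X k)).trace.re := by
          gcongr with k
          exact hstep k
      _ ≤ _ := hlast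
      _ = _ := by
          rw [add_assoc, Nat.cast_succ, add_smul, one_smul]

/-- The Laplace transform bound behind the matrix Bernstein inequality, for uniform sampling. -/
theorem bernstein_trace_exp_le {c : ℝ} (hc : c * Fintype.card κ = 1)
    {D : κ → Matrix ι ι ℂ} (hD : ∀ k, (D k).IsHermitian) {R V t : ℝ} (ht : 0 ≤ t)
    (htR : t * R < 3) (hR : ∀ k, NonnegForm (R • (1 : Matrix ι ι ℂ) - D k))
    (hV : NonnegForm (V • (1 : Matrix ι ι ℂ) - c • ∑ k, D k * D k)) (m : ℕ) :
    c ^ m * ∑ ω : Fin m → κ,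
      (NormedSpace.exp (t • (∑ j, D (ω j) - (m : ℝ) • c • ∑ k, D k))).trace.re ≤
      Fintype.card ι * Real.exp (m * (t ^ 2 / 2 / (1 - t * R / 3) * V)) := by
  set g := t ^ 2 / 2 / (1 - t * R / 3) with hg
  have hg0 : 0 ≤ g := div_nonneg (by positivity) (by linarith)
  have hcard : (0 : ℝ) < Fintype.card κ := by exact_mod_cast Fintype.card_pos
  have hc0 : 0 < c := pos_of_mul_pos_left (hc ▸ one_pos) hcard.le
  set M := c • ∑ k, D k with hM
  have hMH : M.IsHermitian := isHermitian_real_smul (isHermitian_sum hD) c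
  have h1H : (1 : Matrix ι ι ℂ).IsHermitian := Matrix.isHermitian_one
  have hle : NonnegForm ((t • M + (g * V) • (1 : Matrix ι ι ℂ)) -
      (c • ∑ k, NormedSpace.exp (t • D k) - 1)) := by
    have h := (hV.smul hg0).add ((nonnegForm_sum fun k =>
      nonnegForm_bernstein (hD k) (hR k) ht htR).smul hc0.le)
    convert h using 1
    have hone : c • (Fintype.card κ • (1 : Matrix ι ι ℂ)) = 1 := by
      rw [← Nat.cast_smul_eq_nsmul ℝ, smul_smul, hc, one_smul]
    simp only [Finset.sum_sub_distrib, Finset.sum_add_distrib, Finset.sum_const,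
      Finset.card_univ, smul_sub, smul_add, hone, ← Finset.smul_sum, hM, ← hg]
    rw [smul_comm c t, smul_comm c g, smul_smul g V]
    abel
  have h := sum_trace_exp_le hc0
    ((isHermitian_real_smul hMH t).add (isHermitian_real_smul h1H (g * V)))
    (fun k => isHermitian_real_smul (hD k) t) hle m (-((m * t) • M))
    (isHermitian_real_smul hMH _).neg
  have hrhs : (NormedSpace.exp (-((m * t) • M) + (m : ℝ) • (t • M +
      (g * V) • (1 : Matrix ι ι ℂ)))).trace.re = Fintype.card ι * Real.exp (m * (g * V)) := by
    have : -((m * t) • M) + (m : ℝ) • (t • M + (g * V) • (1 : Matrix ι ι ℂ)) =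
        spec 1 (fun _ => m * (g * V)) := by
      rw [smul_add, smul_smul (m : ℝ) t M, neg_add_cancel_left]
      conv_lhs => rw [← spec_one (one_mem _), smul_spec, smul_spec]
      simp
    rw [this, exp_spec (one_mem _), trace_spec (one_mem _)]
    simp
  rw [hrhs] at h
  convert h using 7
  rw [smul_sub, Finset.smul_sum, smul_smul, mul_comm t, sub_eq_neg_add]

end Bernstein

section Dilation

theorem dotProduct_mul_self_mulVec {ι : Type*} [Fintype ι] {A : Matrix ι ι ℂ}
    (hA : A.IsHermitian) (v : ι → ℂ) :
    (star v ⬝ᵥ (A * A) *ᵥ v).re = sqNorm (A *ᵥ v) := by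
  rw [← re_star_dotProduct_self, Matrix.star_mulVec, hA.eq, ← Matrix.dotProduct_mulVec,
    Matrix.mulVec_mulVec]

theorem sqNorm_smul {α : Type*} [Fintype α] (c : ℝ) (v : α → ℂ) :
    sqNorm (c • v) = c ^ 2 * sqNorm v := by
  simp [sqNorm, mul_pow, Finset.mul_sum]

theorem dotProduct_real_smul_one_mulVec {ι : Type*} [Fintype ι] [DecidableEq ι] (c : ℝ)
    (v : ι → ℂ) : (star v ⬝ᵥ (c • (1 : Matrix ι ι ℂ)) *ᵥ v).re = c * sqNorm v := by
  rw [Matrix.smul_mulVec, Matrix.one_mulVec, dotProduct_smul, Complex.smul_re,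
    re_star_dotProduct_self, smul_eq_mul]

theorem two_mul_re_dotProduct_le {α : Type*} [Fintype α] (R : ℝ) (v w : α → ℂ) :
    2 * R * (star v ⬝ᵥ w).re ≤ R ^ 2 * sqNorm v + sqNorm w := by
  simp only [sqNorm, dotProduct, Complex.re_sum, Finset.mul_sum, ← Finset.sum_add_distrib]
  refine Finset.sum_le_sum fun i _ => ?_
  rw [← Complex.normSq_eq_norm_sq, ← Complex.normSq_eq_norm_sq, Complex.normSq_apply,
    Complex.normSq_apply]
  simp only [Pi.star_apply, Complex.star_def, Complex.mul_re, Complex.conj_re, Complex.conj_im]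
  nlinarith [sq_nonneg (R * (v i).re - (w i).re), sq_nonneg (R * (v i).im - (w i).im)]

theorem nonnegForm_of_sqNorm_le {ι : Type*} [Fintype ι] [DecidableEq ι] {A : Matrix ι ι ℂ}
    {R : ℝ} (hR : 0 < R) (h : ∀ v, sqNorm (A *ᵥ v) ≤ R ^ 2 * sqNorm v) :
    NonnegForm (R • (1 : Matrix ι ι ℂ) - A) := fun v => by
  rw [Matrix.sub_mulVec, dotProduct_sub, Complex.sub_re, dotProduct_real_smul_one_mulVec,
    sub_nonneg]
  have h1 := two_mul_re_dotProduct_le R v (A *ᵥ v)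
  have h2 := h v
  refine le_of_mul_le_mul_left (a := 2 * R) ?_ (by positivity)
  linarith

theorem sqNorm_spec_mulVec_le {ι : Type*} [Fintype ι] [DecidableEq ι] {U : Matrix ι ι ℂ}
    (hU : U ∈ Matrix.unitaryGroup ι ℂ) {d : ι → ℝ} {r : ℝ} (hd : ∀ i, |d i| ≤ r) (v : ι → ℂ) :
    sqNorm (spec U d *ᵥ v) ≤ r ^ 2 * sqNorm v := by
  have h1 := dotProduct_spec_mulVec U (fun _ => 1) v
  rw [spec_one hU, Matrix.one_mulVec, re_star_dotProduct_self] at h1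
  rw [← dotProduct_mul_self_mulVec (spec_isHermitian U d), spec_mul hU, dotProduct_spec_mulVec,
    h1, Finset.mul_sum]
  refine Finset.sum_le_sum fun i _ => ?_
  rw [one_mul, ← abs_mul_abs_self (d i), ← sq]
  gcongr
  exact hd i

variable {α β : Type*}

/-- The Hermitian dilation of a rectangular matrix. -/
def dilation (Y : Matrix α β ℂ) : Matrix (α ⊕ β) (α ⊕ β) ℂ := Matrix.fromBlocks 0 Y Yᴴ 0

theorem dilation_isHermitian (Y : Matrix α β ℂ) : (dilation Y).IsHermitian := by
  simp [dilation, Matrix.IsHermitian, Matrix.fromBlocks_conjTranspose]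

theorem dilation_add (Y Z : Matrix α β ℂ) : dilation (Y + Z) = dilation Y + dilation Z := by
  simp [dilation, Matrix.fromBlocks_add, Matrix.conjTranspose_add]

theorem dilation_smul (c : ℝ) (Y : Matrix α β ℂ) : dilation (c • Y) = c • dilation Y := by
  simp [dilation, Matrix.fromBlocks_smul, Matrix.conjTranspose_smul]

/-- The dilation as a real-linear map. -/
def dilationₗ : Matrix α β ℂ →ₗ[ℝ] Matrix (α ⊕ β) (α ⊕ β) ℂ where
  toFun := dilation
  map_add' := dilation_add
  map_smul' := dilation_smul

variable [Fintype α] [Fintype β]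

theorem sqNorm_dilation_mulVec (Y : Matrix α β ℂ) (z : α ⊕ β → ℂ) :
    sqNorm (dilation Y *ᵥ z) = sqNorm (Y *ᵥ (z ∘ Sum.inr)) + sqNorm (Yᴴ *ᵥ (z ∘ Sum.inl)) := by
  simp [dilation, Matrix.fromBlocks_mulVec, sqNorm]

theorem sqNorm_sum (z : α ⊕ β → ℂ) :
    sqNorm z = sqNorm (z ∘ Sum.inl) + sqNorm (z ∘ Sum.inr) := by
  simp [sqNorm]

variable [DecidableEq α] [DecidableEq β]

theorem exp_neg_dilation_trace (Y : Matrix α β ℂ) :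
    (NormedSpace.exp (-dilation Y)).trace = (NormedSpace.exp (dilation Y)).trace := by
  let S : Matrix (α ⊕ β) (α ⊕ β) ℂ := Matrix.fromBlocks 1 0 0 (-1)
  have hSS : S * S = 1 := by simp [S, Matrix.fromBlocks_multiply]
  have hS : S⁻¹ = S := Matrix.inv_eq_right_inv hSS
  have hconj : -dilation Y = S * dilation Y * S⁻¹ := by
    rw [hS]
    simp [S, dilation, Matrix.fromBlocks_multiply, Matrix.fromBlocks_neg]
  rw [hconj, Matrix.exp_conj _ _ (IsUnit.of_mul_eq_one _ hSS), Matrix.trace_mul_comm, hS,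
    ← Matrix.mul_assoc, hSS, one_mul]

theorem re_trace_exp_pos {ι : Type*} [Fintype ι] [DecidableEq ι] [Nonempty ι]
    {P : Matrix ι ι ℂ} (hP : P.IsHermitian) : 0 < (NormedSpace.exp P).trace.re := by
  obtain ⟨U, hU, p, rfl⟩ := exists_eq_spec hP
  rw [exp_spec hU, trace_spec hU]
  exact Finset.sum_pos (fun i _ => Real.exp_pos _) Finset.univ_nonempty

/-- The trace exponential of the dilation controls the operator norm. -/
theorem sqNorm_mulVec_le_log_trace [Nonempty α] (Y : Matrix α β ℂ) :
    0 ≤ Real.log (NormedSpace.exp (dilation Y)).trace.re ∧ ∀ v, sqNorm (Y *ᵥ v) ≤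
      Real.log (NormedSpace.exp (dilation Y)).trace.re ^ 2 * sqNorm v := by
  have hpos := re_trace_exp_pos (dilation_isHermitian Y)
  set K := (NormedSpace.exp (dilation Y)).trace.re with hK
  obtain ⟨U, hU, p, hp⟩ := exists_eq_spec (dilation_isHermitian Y)
  have hle : ∀ i, |p i| ≤ Real.log K := fun i => by
    refine abs_le'.2 ⟨?_, ?_⟩ <;> refine (Real.le_log_iff_exp_le hpos).2 ?_
    · rw [hK, hp, exp_spec hU, trace_spec hU]
      exact Finset.single_le_sum (f := fun i => Real.exp (p i))
        (fun j _ => (Real.exp_pos _).le) (Finset.mem_univ i)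
    · have : -dilation Y = spec U (fun i => -p i) := by
        rw [hp, ← neg_one_smul ℝ (spec U p), smul_spec]
        simp
      rw [hK, ← exp_neg_dilation_trace, this, exp_spec hU, trace_spec hU]
      exact Finset.single_le_sum (f := fun i => Real.exp (-p i))
        (fun j _ => (Real.exp_pos _).le) (Finset.mem_univ i)
  refine ⟨(abs_nonneg _).trans (hle (Sum.inl (Classical.arbitrary α))), fun v => ?_⟩
  have h := sqNorm_spec_mulVec_le hU hle (Sum.elim 0 v)
  rw [← hp, sqNorm_dilation_mulVec, sqNorm_sum] at h
  simpa [sqNorm] using h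

/-- The matrix Bernstein inequality for the empirical mean of a uniform sample, in counting form:
`S` is any set of samples for which the deviation has operator norm at least `δ`. -/
theorem rectangular_bernstein [Nonempty α] {κ : Type*} [Fintype κ] [Nonempty κ] {c : ℝ}
    (hc : c * Fintype.card κ = 1) {Y : κ → Matrix α β ℂ} {R V δ : ℝ} (hR : 0 < R) (hV : 0 < V)
    (hδ : 0 < δ) (hYR : ∀ k v, sqNorm (Y k *ᵥ v) ≤ R ^ 2 * sqNorm v)
    (hYR' : ∀ k v, sqNorm ((Y k)ᴴ *ᵥ v) ≤ R ^ 2 * sqNorm v)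
    (hYV : ∀ v, c * ∑ k, sqNorm (Y k *ᵥ v) ≤ V * sqNorm v)
    (hYV' : ∀ v, c * ∑ k, sqNorm ((Y k)ᴴ *ᵥ v) ≤ V * sqNorm v) {m : ℕ} (hm : 0 < m)
    (S : Finset (Fin m → κ))
    (hS : ∀ ω ∈ S, ∀ r, 0 ≤ r → (∀ v, sqNorm (((m : ℝ)⁻¹ • ∑ j, Y (ω j) - c • ∑ k, Y k) *ᵥ v) ≤
      r ^ 2 * sqNorm v) → δ ≤ r) :
    c ^ m * S.card ≤ (Fintype.card α + Fintype.card β) *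
      Real.exp (-(m * (δ ^ 2 / 2 / (V + R * δ / 3)))) := by
  have hW : 0 < V + R * δ / 3 := by positivity
  set t := δ / (V + R * δ / 3) with ht
  have ht0 : 0 < t := div_pos hδ hW
  have hm' : (0 : ℝ) < m := by exact_mod_cast hm
  have hcard : (0 : ℝ) < Fintype.card κ := by exact_mod_cast Fintype.card_pos
  have hc0 : 0 < c := pos_of_mul_pos_left (hc ▸ one_pos) hcard.le
  have htR : t * R < 3 := by
    rw [ht, div_mul_eq_mul_div, div_lt_iff₀ hW]
    linarith
  have hDR : ∀ k, NonnegForm (R • (1 : Matrix (α ⊕ β) (α ⊕ β) ℂ) - dilation (Y k)) := fun k =>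
    nonnegForm_of_sqNorm_le hR fun z => by
      rw [sqNorm_dilation_mulVec, sqNorm_sum]
      linarith [hYR k (z ∘ Sum.inr), hYR' k (z ∘ Sum.inl)]
  have hDV : NonnegForm (V • (1 : Matrix (α ⊕ β) (α ⊕ β) ℂ) -
      c • ∑ k, dilation (Y k) * dilation (Y k)) := fun z => by
    rw [Matrix.sub_mulVec, dotProduct_sub, Complex.sub_re, dotProduct_real_smul_one_mulVec,
      Matrix.smul_mulVec, Matrix.sum_mulVec, dotProduct_smul, dotProduct_sum, Complex.smul_re,
      Complex.re_sum, sub_nonneg, sqNorm_sum]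
    simp only [dotProduct_mul_self_mulVec (dilation_isHermitian _), sqNorm_dilation_mulVec,
      Finset.sum_add_distrib, smul_eq_mul]
    linarith [hYV (z ∘ Sum.inr), hYV' (z ∘ Sum.inl)]
  have hmain := bernstein_trace_exp_le hc (fun k => dilation_isHermitian (Y k)) ht0.le htR hDR
    hDV m
  have hZ : ∀ ω : Fin m → κ, t • (∑ j, dilation (Y (ω j)) - (m : ℝ) • c • ∑ k, dilation (Y k)) =
      dilation ((t * m) • ((m : ℝ)⁻¹ • ∑ j, Y (ω j) - c • ∑ k, Y k)) := fun ω => by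
    change t • (∑ j, dilationₗ (Y (ω j)) - (m : ℝ) • c • ∑ k, dilationₗ (Y k)) =
      dilationₗ ((t * m) • ((m : ℝ)⁻¹ • ∑ j, Y (ω j) - c • ∑ k, Y k))
    rw [← map_sum, ← map_sum, ← map_smul, ← map_smul, ← map_sub, ← map_smul, mul_smul,
      smul_sub (m : ℝ), smul_inv_smul₀ hm'.ne']
  simp only [hZ] at hmain
  have hterm : ∀ ω ∈ S, Real.exp (t * m * δ) ≤ (NormedSpace.exp
      (dilation ((t * m) • ((m : ℝ)⁻¹ • ∑ j, Y (ω j) - c • ∑ k, Y k)))).trace.re := by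
    intro ω hω
    obtain ⟨h0, h1⟩ := sqNorm_mulVec_le_log_trace
      ((t * m) • ((m : ℝ)⁻¹ • ∑ j, Y (ω j) - c • ∑ k, Y k))
    rw [← Real.le_log_iff_exp_le (re_trace_exp_pos (dilation_isHermitian _))]
    have htm : 0 < t * m := by positivity
    rw [mul_comm, ← le_div_iff₀ htm]
    refine hS ω hω _ (div_nonneg h0 htm.le) fun v => ?_
    have := h1 v
    rw [Matrix.smul_mulVec, sqNorm_smul] at this
    rw [div_pow, div_mul_eq_mul_div, le_div_iff₀ (by positivity)]
    linarith
  have hsum : S.card * Real.exp (t * m * δ) ≤ ∑ ω : Fin m → κ, (NormedSpace.exp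
      (dilation ((t * m) • ((m : ℝ)⁻¹ • ∑ j, Y (ω j) - c • ∑ k, Y k)))).trace.re := by
    rw [← nsmul_eq_mul]
    refine (Finset.card_nsmul_le_sum S _ _ hterm).trans
      (Finset.sum_le_sum_of_subset_of_nonneg (Finset.subset_univ S) fun ω _ _ => ?_)
    exact (re_trace_exp_pos (dilation_isHermitian _)).le
  have hfin : c ^ m * (S.card * Real.exp (t * m * δ)) ≤ Fintype.card (α ⊕ β) *
      Real.exp (m * (t ^ 2 / 2 / (1 - t * R / 3) * V)) :=
    (mul_le_mul_of_nonneg_left hsum (pow_pos hc0 m).le).trans hmain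
  have hexp : (m : ℝ) * (t ^ 2 / 2 / (1 - t * R / 3) * V) - t * m * δ =
      -(m * (δ ^ 2 / 2 / (V + R * δ / 3))) := by
    have h1 : 1 - t * R / 3 = V / (V + R * δ / 3) := by
      rw [ht, eq_div_iff hW.ne']
      field_simp
      ring
    rw [h1, ht]
    field_simp
    ring
  rw [← hexp, Real.exp_sub, ← mul_div_assoc, le_div_iff₀ (Real.exp_pos _), mul_assoc]
  simpa using hfin

end Dilation

section SpectralNorm

theorem sqNorm_eq_norm_sq {d : ℕ} (v : Fin d → ℂ) : sqNorm v = ‖WithLp.toLp 2 v‖ ^ 2 := by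
  rw [EuclideanSpace.norm_sq_eq]; rfl

theorem specNorm_le {d e : ℕ} {A : Matrix (Fin d) (Fin e) ℂ} {r : ℝ} (hr : 0 ≤ r)
    (h : ∀ v, sqNorm (A *ᵥ v) ≤ r ^ 2 * sqNorm v) : specNorm A ≤ r := by
  refine ContinuousLinearMap.opNorm_le_bound _ hr fun v => ?_
  have := h v.ofLp
  rw [sqNorm_eq_norm_sq, sqNorm_eq_norm_sq, ← mul_pow] at this
  exact le_of_sq_le_sq this (by positivity)

theorem sqNorm_mulVec_le_specNorm {d e : ℕ} (A : Matrix (Fin d) (Fin e) ℂ) (v : Fin e → ℂ) :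
    sqNorm (A *ᵥ v) ≤ specNorm A ^ 2 * sqNorm v := by
  rw [sqNorm_eq_norm_sq, sqNorm_eq_norm_sq, ← mul_pow]
  exact pow_le_pow_left₀ (norm_nonneg _) (ContinuousLinearMap.le_opNorm
    (LinearMap.toContinuousLinearMap (Matrix.toEuclideanLin A)) (WithLp.toLp 2 v)) 2

theorem specNorm_nonneg {d e : ℕ} (A : Matrix (Fin d) (Fin e) ℂ) : 0 ≤ specNorm A :=
  norm_nonneg _

end SpectralNorm

section QuadraticBounds

variable {α β : Type*} [Fintype α] [Fintype β]

theorem abs_re_dotProduct_le {θ : ℝ} (hθ : 0 ≤ θ) {v w : α → ℂ}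
    (h : sqNorm w ≤ θ ^ 2 * sqNorm v) : |(star v ⬝ᵥ w).re| ≤ θ * sqNorm v := by
  refine abs_le_of_sq_le_sq ?_ (mul_nonneg hθ (sqNorm_nonneg v))
  have := discrim_le_zero (a := sqNorm v) (b := -(2 * (star v ⬝ᵥ w).re))
    (c := θ ^ 2 * sqNorm v) fun R => by linarith [two_mul_re_dotProduct_le R v w]
  rw [discrim] at this
  linarith

theorem norm_dotProduct_sq_le (v w : α → ℂ) : ‖v ⬝ᵥ w‖ ^ 2 ≤ sqNorm v * sqNorm w := by
  calc ‖v ⬝ᵥ w‖ ^ 2 ≤ (∑ i, ‖v i‖ * ‖w i‖) ^ 2 := by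
        gcongr
        simpa [dotProduct] using norm_sum_le Finset.univ fun i => v i * w i
    _ ≤ _ := Finset.sum_mul_sq_le_sq_mul_sq _ _ _

theorem sqNorm_vecMulVec_mulVec (a : α → ℂ) (b v : β → ℂ) :
    sqNorm (Matrix.vecMulVec a b *ᵥ v) = sqNorm a * ‖b ⬝ᵥ v‖ ^ 2 := by
  rw [Matrix.vecMulVec_mulVec]
  simp [sqNorm, mul_pow, Finset.sum_mul]

theorem sqNorm_conjTranspose_mulVec_le {A : Matrix α β ℂ} {c : ℝ} (hc : 0 < c)
    (h : ∀ v, sqNorm (A *ᵥ v) ≤ c * sqNorm v) (w : α → ℂ) :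
    sqNorm (Aᴴ *ᵥ w) ≤ c * sqNorm w := by
  have h1 := two_mul_re_dotProduct_le c w (A *ᵥ (Aᴴ *ᵥ w))
  rw [Matrix.dotProduct_mulVec, ← Matrix.conjTranspose_conjTranspose A, ← Matrix.star_mulVec,
    Matrix.conjTranspose_conjTranspose, re_star_dotProduct_self,
    Matrix.conjTranspose_conjTranspose] at h1
  nlinarith [h (Aᴴ *ᵥ w)]

theorem sqNorm_comp_coe_le (J : Finset α) (v : α → ℂ) :
    sqNorm (fun j : J => v j) ≤ sqNorm v := by
  rw [sqNorm, Finset.sum_coe_sort J fun i => ‖v i‖ ^ 2]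
  exact Finset.sum_le_univ_sum_of_nonneg fun i => sq_nonneg _

theorem sum_norm_dotProduct_sq_le {A : Matrix α β ℂ} {c : ℝ} (hc : 0 < c)
    (h : ∀ v, sqNorm (A *ᵥ v) ≤ c * sqNorm v) (J : Finset β) (y : J → ℂ) :
    ∑ k, ‖(fun j : J => A k j) ⬝ᵥ y‖ ^ 2 ≤ c * sqNorm y := by
  have hsub (w : α → ℂ) : sqNorm (Aᴴ.submatrix (fun j : J => (j : β)) id *ᵥ w) ≤ c * sqNorm w :=
    (sqNorm_comp_coe_le J (Aᴴ *ᵥ w)).trans (sqNorm_conjTranspose_mulVec_le hc h w)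
  have := sqNorm_conjTranspose_mulVec_le hc hsub y
  rwa [Matrix.conjTranspose_submatrix, Matrix.conjTranspose_conjTranspose] at this

theorem sqNorm_mulVec_le_of_projection [DecidableEq α] {P : Matrix α α ℂ} (hP : Pᴴ = P)
    (hPP : P * P = P) (w : α → ℂ) : sqNorm (P *ᵥ w) ≤ sqNorm w := by
  have h1 := dotProduct_mul_self_mulVec (A := P) hP w
  rw [hPP] at h1
  linarith [two_mul_re_dotProduct_le 1 w (P *ᵥ w)]

end QuadraticBounds

section Frame

variable {d e : ℕ} {T : Matrix (Fin d) (Fin e) ℂ} {γ : ℝ}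

theorem abs_frame_sub_le (T : Matrix (Fin d) (Fin e) ℂ) (γ : ℝ) (v : Fin e → ℂ) :
    |γ * sqNorm (T *ᵥ v) - sqNorm v| ≤ specNorm ((γ : ℂ) • (Tᴴ * T) - 1) * sqNorm v := by
  have h := abs_re_dotProduct_le (specNorm_nonneg _)
    (sqNorm_mulVec_le_specNorm ((γ : ℂ) • (Tᴴ * T) - 1) v)
  rwa [Matrix.sub_mulVec, Matrix.one_mulVec, Matrix.smul_mulVec, dotProduct_sub, dotProduct_smul,
    ← Matrix.mulVec_mulVec, Matrix.dotProduct_mulVec, ← Matrix.star_mulVec, Complex.sub_re,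
    re_star_dotProduct_self, smul_eq_mul, Complex.re_ofReal_mul, re_star_dotProduct_self] at h

theorem sqNorm_conjTranspose_mulVec_le_frame (hγ : 0 < γ)
    (hθ : specNorm ((γ : ℂ) • (Tᴴ * T) - 1) < 1) (w : Fin d → ℂ) :
    sqNorm (Tᴴ *ᵥ w) ≤
      γ⁻¹ * (1 / (1 - specNorm ((γ : ℂ) • (Tᴴ * T) - 1))) * sqNorm w := by
  have hpos : 0 < 1 - specNorm ((γ : ℂ) • (Tᴴ * T) - 1) := by linarith
  refine sqNorm_conjTranspose_mulVec_le (by positivity) (fun v => ?_) w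
  have h1 := (abs_le.1 (abs_frame_sub_le T γ v)).2
  have h2 : 1 + specNorm ((γ : ℂ) • (Tᴴ * T) - 1) ≤
      1 / (1 - specNorm ((γ : ℂ) • (Tᴴ * T) - 1)) := by
    rw [le_div_iff₀ hpos]
    nlinarith [sq_nonneg (specNorm ((γ : ℂ) • (Tᴴ * T) - 1))]
  rw [mul_assoc, inv_mul_eq_div, le_div_iff₀ hγ]
  nlinarith [sqNorm_nonneg v]

theorem sqNorm_pseudoinverse_mulVec_le {Tdag : Matrix (Fin e) (Fin d) ℂ}
    (hmp : IsMoorePenrose T Tdag) (hγ : 0 < γ)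
    (hθ : specNorm ((γ : ℂ) • (Tᴴ * T) - 1) < 1) (w : Fin d → ℂ) :
    sqNorm (Tdag *ᵥ w) ≤ γ * (1 / (1 - specNorm ((γ : ℂ) • (Tᴴ * T) - 1))) * sqNorm w := by
  have hpos : 0 < 1 - specNorm ((γ : ℂ) • (Tᴴ * T) - 1) := by linarith
  have h1 := (abs_le.1 (abs_frame_sub_le T γ (Tdag *ᵥ w))).1
  have h2 := sqNorm_mulVec_le_of_projection hmp.2.2.1
    (by rw [← Matrix.mul_assoc, hmp.1]) w
  rw [← Matrix.mulVec_mulVec] at h2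
  rw [mul_one_div, div_mul_eq_mul_div, le_div_iff₀ hpos]
  nlinarith

theorem mul_norm_sq_le_locIncoh {γ : ℝ} (hγ : 0 ≤ γ) (A : Matrix (Fin d) (Fin e) ℂ) (i : Fin d)
    (k : Fin e) : e * γ * ‖A i k‖ ^ 2 ≤ locIncoh γ A k := by
  unfold locIncoh linfnorm
  gcongr
  exact le_ciSup (f := fun i => ‖A i k‖) (Set.finite_range _).bddAbove i

theorem locIncoh_le_incoherence (T Ttil : Matrix (Fin d) (Fin e) ℂ) (k : Fin e) :
    locIncoh γ T k ≤ incoherence γ T Ttil ∧ locIncoh γ⁻¹ Ttil k ≤ incoherence γ T Ttil :=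
  max_le_iff.1 (le_ciSup (f := fun k => max (locIncoh γ T k) (locIncoh γ⁻¹ Ttil k))
    (Set.finite_range _).bddAbove k)

theorem mul_sqNorm_coe_le {a μ : ℝ} (J : Finset (Fin d)) {v : Fin d → ℂ}
    (h : ∀ i, a * ‖v i‖ ^ 2 ≤ μ) : a * sqNorm (fun j : J => v j) ≤ J.card * μ := by
  rw [sqNorm, Finset.sum_coe_sort J fun i => ‖v i‖ ^ 2, Finset.mul_sum, ← nsmul_eq_mul]
  exact Finset.sum_le_card_nsmul _ _ _ fun i _ => h i

theorem incoherence_pos (he : 0 < e) (hγ : 0 < γ)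
    (hθ : specNorm ((γ : ℂ) • (Tᴴ * T) - 1) < 1) (Ttil : Matrix (Fin d) (Fin e) ℂ) :
    0 < incoherence γ T Ttil := by
  by_contra! hle
  have hT : T = 0 := by
    ext i k
    have h := ((mul_norm_sq_le_locIncoh hγ.le T i k).trans
      (locIncoh_le_incoherence T Ttil k).1).trans hle
    have he' : (0 : ℝ) < e := by exact_mod_cast he
    by_contra hne
    have : 0 < ‖T i k‖ := norm_pos_iff.2 hne
    have : 0 < e * γ * ‖T i k‖ ^ 2 := by positivity
    linarith
  have h := (abs_le.1 (abs_frame_sub_le T γ (Pi.single ⟨0, he⟩ 1))).1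
  have h1 : sqNorm (Pi.single (⟨0, he⟩ : Fin e) (1 : ℂ)) = 1 := by
    simp [sqNorm, Pi.single_apply, apply_ite]
  rw [h1, hT] at h
  rw [hT] at hθ
  simp [sqNorm] at h hθ
  linarith

end Frame

section Sampling

variable {n N m : ℕ}

theorem projMat_mulVec (J : Finset (Fin N)) (v : Fin N → ℂ) (i : Fin N) :
    (projMat (J : Set (Fin N)) *ᵥ v) i = if i ∈ J then v i else 0 := by
  simp [projMat, Matrix.mulVec, dotProduct, ite_and]

theorem sqNorm_projMat_mul_mul_projMat_mulVec (J : Finset (Fin N))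
    (A : Matrix (Fin N) (Fin N) ℂ) (v : Fin N → ℂ) :
    sqNorm ((projMat (J : Set (Fin N)) * A * projMat (J : Set (Fin N))) *ᵥ v) =
      sqNorm (A.submatrix (fun j : J => (j : Fin N)) (fun j : J => (j : Fin N)) *ᵥ
        fun j : J => v j) := by
  rw [← Matrix.mulVec_mulVec, ← Matrix.mulVec_mulVec]
  have h (i : Fin N) : (A *ᵥ projMat (J : Set (Fin N)) *ᵥ v) i = ∑ j : J, A i j * v j := by
    simp only [Matrix.mulVec.eq_def A, dotProduct, projMat_mulVec, mul_ite, mul_zero]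
    rw [Finset.sum_ite_mem, Finset.univ_inter, Finset.sum_coe_sort J fun j => A i j * v j]
  simp only [sqNorm, projMat_mulVec, h]
  refine Eq.trans ?_ (Finset.sum_coe_sort J fun i => ‖∑ j : J, A i j * v j‖ ^ 2).symm
  simp [apply_ite]

/-- The rank-one contribution of one sampled index, restricted to the coordinates in `J`. -/
def sampleTerm (T : Matrix (Fin N) (Fin n) ℂ) (Tdag : Matrix (Fin n) (Fin N) ℂ)
    (J : Finset (Fin N)) (k : Fin n) : Matrix J J ℂ :=
  (n : ℝ) • Matrix.vecMulVec (fun i : J => T i k) (fun j : J => Tdag k j)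

theorem submatrix_sampling_deviation (hn : 0 < n) (T : Matrix (Fin N) (Fin n) ℂ)
    (Tdag : Matrix (Fin n) (Fin N) ℂ) (J : Finset (Fin N)) (ω : Fin m → Fin n) :
    (((n : ℂ) / m) • (T * (sampMat ω)ᴴ * sampMat ω * Tdag) - T * Tdag).submatrix
        (fun j : J => (j : Fin N)) (fun j : J => (j : Fin N)) =
      (m : ℝ)⁻¹ • ∑ j, sampleTerm T Tdag J (ω j) -
        (n : ℝ)⁻¹ • ∑ k, sampleTerm T Tdag J k := by
  have h1 (l : Fin m) (j : Fin N) : (sampMat ω * Tdag) l j = Tdag (ω l) j := by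
    simp [Matrix.mul_apply, sampMat]
  have h2 (l : Fin m) (i : Fin N) : (T * (sampMat ω)ᴴ) i l = T i (ω l) := by
    simp [Matrix.mul_apply, sampMat, apply_ite]
  have hn' : (n : ℂ) ≠ 0 := by exact_mod_cast hn.ne'
  ext i j
  rw [Matrix.mul_assoc]
  simp only [sampleTerm, Matrix.submatrix_apply, Matrix.sub_apply, Matrix.smul_apply,
    Matrix.mul_apply (M := T * (sampMat ω)ᴴ), h1, h2, Matrix.sum_apply, Matrix.vecMulVec_apply,
    ← Finset.smul_sum, Matrix.mul_apply (M := T) (N := Tdag), Complex.real_smul, smul_eq_mul]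
  push_cast
  rw [inv_mul_cancel_left₀ hn']
  ring

end Sampling

section UniformMeasure

theorem pi_uniform_finset_le {κ : Type*} [Fintype κ] [MeasurableSpace κ]
    [MeasurableSingletonClass κ] {ν : Measure κ} [IsProbabilityMeasure ν] {c : ℝ} (hc : 0 ≤ c)
    (hν : ∀ k, ν {k} = ENNReal.ofReal c) {m : ℕ} (S : Finset (Fin m → κ)) :
    (Measure.pi fun _ : Fin m => ν) S ≤ ENNReal.ofReal (c ^ m * S.card) := by
  calc (Measure.pi fun _ : Fin m => ν) S
      = (Measure.pi fun _ : Fin m => ν) (⋃ ω ∈ S, {ω}) := by congr 1; ext; simp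
    _ ≤ ∑ ω ∈ S, (Measure.pi fun _ : Fin m => ν) {ω} := measure_biUnion_finset_le _ _
    _ = ENNReal.ofReal (c ^ m * S.card) := by
      simp only [Measure.pi_singleton, hν, Finset.prod_const, Finset.card_univ, Fintype.card_fin,
        Finset.sum_const, nsmul_eq_mul]
      rw [ENNReal.ofReal_mul (by positivity), ENNReal.ofReal_pow hc, ENNReal.ofReal_natCast,
        mul_comm]

end UniformMeasure

section SampleTerm

variable {n N : ℕ} {T : Matrix (Fin N) (Fin n) ℂ} {Tdag : Matrix (Fin n) (Fin N) ℂ}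
  {J : Finset (Fin N)}

theorem sqNorm_sampleTerm_mulVec (k : Fin n) (v : J → ℂ) :
    sqNorm (sampleTerm T Tdag J k *ᵥ v) =
      n ^ 2 * (sqNorm (fun i : J => T i k) * ‖(fun j : J => Tdag k j) ⬝ᵥ v‖ ^ 2) := by
  rw [sampleTerm, Matrix.smul_mulVec, sqNorm_smul, sqNorm_vecMulVec_mulVec]

theorem conjTranspose_sampleTerm (k : Fin n) :
    (sampleTerm T Tdag J k)ᴴ = sampleTerm Tdagᴴ Tᴴ J k := by
  rw [sampleTerm, Matrix.conjTranspose_smul, Matrix.conjTranspose_vecMulVec]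
  simp [sampleTerm, Matrix.conjTranspose_apply, Matrix.vecMulVec]

theorem sqNorm_sampleTerm_mulVec_le {γ μ : ℝ} (hγ : 0 < γ)
    (hT : ∀ i k, n * γ * ‖T i k‖ ^ 2 ≤ μ) (hTdag : ∀ i k, n * γ⁻¹ * ‖Tdag k i‖ ^ 2 ≤ μ)
    (hμ : 0 ≤ μ) (k : Fin n) (v : J → ℂ) :
    sqNorm (sampleTerm T Tdag J k *ᵥ v) ≤ (J.card * μ) ^ 2 * sqNorm v := by
  have ha := mul_sqNorm_coe_le J fun i => hT i k
  have hb := mul_sqNorm_coe_le J fun i => hTdag i k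
  have hv := sqNorm_nonneg v
  have hb0 := sqNorm_nonneg fun j : J => Tdag k j
  have ha0 := sqNorm_nonneg fun i : J => T i k
  calc sqNorm (sampleTerm T Tdag J k *ᵥ v)
      ≤ n ^ 2 * (sqNorm (fun i : J => T i k) * (sqNorm (fun j : J => Tdag k j) * sqNorm v)) := by
        rw [sqNorm_sampleTerm_mulVec]
        gcongr
        exact norm_dotProduct_sq_le _ _
    _ = (n * γ * sqNorm fun i : J => T i k) * (n * γ⁻¹ * sqNorm fun j : J => Tdag k j) *
          sqNorm v := by
        field_simp
    _ ≤ J.card * μ * (J.card * μ) * sqNorm v := by gcongr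
    _ = _ := by ring

theorem average_sqNorm_sampleTerm_mulVec_le (hn : 0 < n) {γ μ K : ℝ} (hγ : 0 < γ) (hK : 0 < K)
    (hT : ∀ i k, n * γ * ‖T i k‖ ^ 2 ≤ μ)
    (hTdag : ∀ w, sqNorm (Tdag *ᵥ w) ≤ γ * K * sqNorm w) (hμ : 0 ≤ μ) (v : J → ℂ) :
    (n : ℝ)⁻¹ * ∑ k, sqNorm (sampleTerm T Tdag J k *ᵥ v) ≤ J.card * μ * K * sqNorm v := by
  have hn' : (0 : ℝ) < n := by exact_mod_cast hn
  have hsum := sum_norm_dotProduct_sq_le (by positivity) hTdag J v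
  calc (n : ℝ)⁻¹ * ∑ k, sqNorm (sampleTerm T Tdag J k *ᵥ v)
      = ∑ k, γ⁻¹ * (n * γ * sqNorm fun i : J => T i k) *
          ‖(fun j : J => Tdag k j) ⬝ᵥ v‖ ^ 2 := by
        rw [Finset.mul_sum]
        refine Finset.sum_congr rfl fun k _ => ?_
        rw [sqNorm_sampleTerm_mulVec]
        field_simp
    _ ≤ ∑ k, γ⁻¹ * (J.card * μ) * ‖(fun j : J => Tdag k j) ⬝ᵥ v‖ ^ 2 := by
        refine Finset.sum_le_sum fun k _ => ?_
        have := mul_sqNorm_coe_le J fun i => hT i k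
        gcongr
    _ ≤ γ⁻¹ * (J.card * μ) * (γ * K * sqNorm v) := by
        rw [← Finset.mul_sum]
        gcongr
    _ = _ := by field_simp

end SampleTerm

/-- Lemma 3 (E1: local isometry on a proper subspace). -/
theorem local_isometry_E1
    (n N m s : ℕ) (hn : 0 < n) (hN : 0 < N) (hm : 0 < m) (hs : 0 < s)
    (T : Matrix (Fin N) (Fin n) ℂ) (Tdag : Matrix (Fin n) (Fin N) ℂ) (γ μ : ℝ)
    (hmp : IsMoorePenrose T Tdag)
    (hbal : IsBalancing T γ)
    (hθ : specNorm ((γ : ℂ) • (Tᴴ * T) - 1) < 1)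
    (hμ : μ ≥ incoherence γ T Tdagᴴ)
    (J : Finset (Fin N)) (hJ : J.card = s)
    (ν : Measure (Fin n)) [IsProbabilityMeasure ν]
    (hν : ∀ k, ν {k} = (n : ℝ≥0∞)⁻¹)
    (δ : ℝ) (hδ : 0 < δ) :
    (Measure.pi fun _ : Fin m => ν)
        {ω | specNorm (projMat (↑J) *
            (((n : ℂ) / m) • (T * (sampMat ω)ᴴ * sampMat ω * Tdag) - T * Tdag) *
            projMat (↑J)) ≥ δ} ≤
      ENNReal.ofReal (2 * s * Real.exp (-((m : ℝ) / (s * μ)) *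
        (δ ^ 2 / 2 / (1 / (1 - specNorm ((γ : ℂ) • (Tᴴ * T) - 1)) + δ / 3)))) := by
  have hn' : (0 : ℝ) < n := by exact_mod_cast hn
  have hm' : (0 : ℝ) < m := by exact_mod_cast hm
  have hs' : (0 : ℝ) < s := by exact_mod_cast hs
  have hγ := hbal.1
  have hμ0 : 0 < μ := (incoherence_pos hn hγ hθ Tdagᴴ).trans_le hμ
  have hK : 0 < 1 / (1 - specNorm ((γ : ℂ) • (Tᴴ * T) - 1)) := one_div_pos.2 (by linarith)
  have hT (i k) : n * γ * ‖T i k‖ ^ 2 ≤ μ :=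
    ((mul_norm_sq_le_locIncoh hγ.le T i k).trans (locIncoh_le_incoherence T Tdagᴴ k).1).trans hμ
  have hTdag (i k) : n * γ⁻¹ * ‖Tdagᴴ i k‖ ^ 2 ≤ μ :=
    ((mul_norm_sq_le_locIncoh (inv_nonneg.2 hγ.le) Tdagᴴ i k).trans
      (locIncoh_le_incoherence T Tdagᴴ k).2).trans hμ
  have hTdag_bound := sqNorm_pseudoinverse_mulVec_le hmp hγ hθ
  have hT_bound := sqNorm_conjTranspose_mulVec_le_frame hγ hθ
  set K := 1 / (1 - specNorm ((γ : ℂ) • (Tᴴ * T) - 1))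
  have : Nonempty (Fin n) := ⟨⟨0, hn⟩⟩
  have : Nonempty J := (Finset.card_pos.1 (hJ ▸ hs)).to_subtype
  let S : Finset (Fin m → Fin n) := Finset.univ.filter fun ω =>
    specNorm (projMat (↑J) *
      (((n : ℂ) / m) • (T * (sampMat ω)ᴴ * sampMat ω * Tdag) - T * Tdag) *
      projMat (↑J)) ≥ δ
  have hbernstein := rectangular_bernstein (c := (n : ℝ)⁻¹) (Y := sampleTerm T Tdag J)
    (R := J.card * μ) (V := J.card * μ * K) (by simp [hn'.ne']) (by rw [hJ]; positivity)
    (by rw [hJ]; positivity) hδ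
    (sqNorm_sampleTerm_mulVec_le hγ hT (by simpa using hTdag) hμ0.le)
    (fun k => by
      rw [conjTranspose_sampleTerm]
      exact sqNorm_sampleTerm_mulVec_le (inv_pos.2 hγ) hTdag (by simpa using hT) hμ0.le k)
    (average_sqNorm_sampleTerm_mulVec_le hn hγ hK hT hTdag_bound hμ0.le)
    (fun v => by
      simp only [conjTranspose_sampleTerm]
      exact average_sqNorm_sampleTerm_mulVec_le hn (inv_pos.2 hγ) hK hTdag hT_bound hμ0.le v)
    hm S (fun ω hω r hr h => (Finset.mem_filter.1 hω).2.trans (specNorm_le hr fun v => by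
      rw [sqNorm_projMat_mul_mul_projMat_mulVec, submatrix_sampling_deviation hn]
      refine (h _).trans ?_
      gcongr
      exact sqNorm_comp_coe_le J v))
  have hexp : -(m * (δ ^ 2 / 2 / (s * μ * K + s * μ * δ / 3))) =
      -((m : ℝ) / (s * μ)) * (δ ^ 2 / 2 / (K + δ / 3)) := by
    field_simp
  rw [Fintype.card_coe, hJ, hexp, ← two_mul] at hbernstein
  refine le_trans ?_ (ENNReal.ofReal_le_ofReal hbernstein)
  refine le_trans (measure_mono fun ω hω => ?_) (pi_uniform_finset_le (by positivity)
    (fun k => by rw [hν, ENNReal.ofReal_inv_of_pos hn', ENNReal.ofReal_natCast]) S)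
  exact Finset.mem_coe.2 (Finset.mem_filter.2 ⟨Finset.mem_univ ω, hω⟩)

end TSR
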